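/- Let S and T be infinite automatic semigroups. Then the direct product S × T is automatic if and only if S² = S and T² = T. -/

import Mathlib

namespace AutoSg

/-- Evaluation of a nonempty word over alphabet `A` in a semigroup `S`
via the letter-interpretation map `ψ`; the empty word evaluates to `none`. -/
def evalWord {S : Type*} [Semigroup S] {A : Type*} (ψ : A → S) : List A → Option S
  | [] => none
  | a :: w => some ((w.map ψ).foldl (· * ·) (ψ a))

/-- The standard padding map `δ_A` on pairs of words, with `none` playing
the role of the padding symbol `$`. -/
def padMap {A : Type*} (u v : List A) : List (Option A × Option A) :=
  List.zipWith Prod.mk (u.map some ++ List.replicate (v.length - u.length) none)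
    (v.map some ++ List.replicate (u.length - v.length) none)

/-- `(A, L)` is an automatic structure for the semigroup `S` with respect to `ψ`. -/
structure IsAutomaticStructure (S : Type*) [Semigroup S] {A : Type*} [Finite A]
    (ψ : A → S) (L : Language A) : Prop where
  nonempty_words : ∀ w ∈ L, w ≠ []
  regular : L.IsRegular
  onto : ∀ s : S, ∃ w ∈ L, evalWord ψ w = some s
  eq_regular : Language.IsRegular
    {p : List (Option A × Option A) |
      ∃ u ∈ L, ∃ v ∈ L, p = padMap u v ∧ evalWord ψ u = evalWord ψ v}
  mul_regular : ∀ a : A, Language.IsRegular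
    {p : List (Option A × Option A) |
      ∃ u ∈ L, ∃ v ∈ L, p = padMap u v ∧ evalWord ψ (u ++ [a]) = evalWord ψ v}

/-- An automatic structure with uniqueness: each element of `S` is represented
by exactly one word of `L`. -/
structure IsAutomaticStructureWithUniqueness (S : Type*) [Semigroup S] {A : Type*} [Finite A]
    (ψ : A → S) (L : Language A) extends IsAutomaticStructure S ψ L : Prop where
  unique : ∀ u ∈ L, ∀ v ∈ L, evalWord ψ u = evalWord ψ v → u = v

/-- A semigroup is automatic if it admits an automatic structure. -/
def IsAutomaticSemigroup (S : Type*) [Semigroup S] : Prop :=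
  ∃ (A : Type) (_ : Finite A) (ψ : A → S) (L : Language A), IsAutomaticStructure S ψ L

/-! ### Closure properties of regular languages -/

section Regular

variable {α β γ : Type*}

/-- Regular languages are closed under preimages of partial letter maps. -/
theorem isRegular_filterMap_preimage (f : α → Option β) {K : Language β} (hK : K.IsRegular) :
    Language.IsRegular {w : List α | w.filterMap f ∈ K} := by
  obtain ⟨σ, hσ, M, rfl⟩ := hK
  let N : DFA α σ := ⟨fun s x => (f x).elim s (M.step s), M.start, M.accept⟩
  have key : ∀ (w : List α) (s : σ), N.evalFrom s w = M.evalFrom s (w.filterMap f) := by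
    intro w
    induction w with
    | nil => intro s; rfl
    | cons x w ih =>
      intro s
      rw [DFA.evalFrom_cons, ih]
      cases h : f x <;> simp [h, N]
  refine ⟨σ, hσ, N, ?_⟩
  ext w
  change N.evalFrom M.start w ∈ M.accept ↔ M.evalFrom M.start (w.filterMap f) ∈ M.accept
  rw [key]

theorem isRegular_map_preimage (f : α → β) {K : Language β} (hK : K.IsRegular) :
    Language.IsRegular {w : List α | w.map f ∈ K} := by
  simpa using isRegular_filterMap_preimage (fun x => some (f x)) hK

/-- Regular languages are closed under images of letter maps. -/
theorem isRegular_map_image (f : α → β) {K : Language α} (hK : K.IsRegular) :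
    Language.IsRegular {w : List β | ∃ v ∈ K, v.map f = w} := by
  classical
  obtain ⟨σ, hσ, M, rfl⟩ := hK
  let N : DFA β (Set σ) :=
    ⟨fun S y => {t | ∃ s ∈ S, ∃ x, f x = y ∧ M.step s x = t}, {M.start},
      {S | ∃ s ∈ S, s ∈ M.accept}⟩
  have key : ∀ (w : List β) (S : Set σ) (t : σ),
      t ∈ N.evalFrom S w ↔ ∃ s ∈ S, ∃ v : List α, v.map f = w ∧ M.evalFrom s v = t := by
    intro w
    induction w with
    | nil => intro S t; simp
    | cons y w ih =>
      intro S t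
      rw [DFA.evalFrom_cons, ih]
      constructor
      · rintro ⟨_, ⟨s, hs, x, rfl, rfl⟩, v, rfl, rfl⟩
        exact ⟨s, hs, x :: v, rfl, rfl⟩
      · rintro ⟨s, hs, v, hv, rfl⟩
        obtain ⟨x, v, rfl, rfl, rfl⟩ := List.map_eq_cons_iff.1 hv
        exact ⟨_, ⟨s, hs, x, rfl, rfl⟩, v, rfl, rfl⟩
  refine ⟨Set σ, inferInstance, N, ?_⟩
  ext w
  change (∃ s ∈ N.evalFrom {M.start} w, s ∈ M.accept) ↔
    ∃ v, M.evalFrom M.start v ∈ M.accept ∧ v.map f = w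
  constructor
  · rintro ⟨s, hs, ha⟩
    obtain ⟨_, rfl, v, hv, rfl⟩ := (key _ _ _).1 hs
    exact ⟨v, ha, hv⟩
  · rintro ⟨v, ha, hv⟩
    exact ⟨_, (key _ _ _).2 ⟨_, rfl, v, hv, rfl⟩, ha⟩

/-- Deleting a block of copies of a fixed letter at the end of words preserves regularity. -/
theorem isRegular_exists_append_replicate (x : α) {K : Language α} (hK : K.IsRegular) :
    Language.IsRegular {w : List α | ∃ m, w ++ List.replicate m x ∈ K} := by
  obtain ⟨σ, hσ, M, rfl⟩ := hK
  let N : DFA α σ :=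
    ⟨M.step, M.start, {s | ∃ m, M.evalFrom s (List.replicate m x) ∈ M.accept}⟩
  refine ⟨σ, hσ, N, ?_⟩
  ext w
  change (∃ m, M.evalFrom (M.evalFrom M.start w) (List.replicate m x) ∈ M.accept) ↔
    ∃ m, M.evalFrom M.start (w ++ List.replicate m x) ∈ M.accept
  simp only [DFA.evalFrom_of_append]

theorem isRegular_forall_mem (P : α → Prop) :
    Language.IsRegular {w : List α | ∀ x ∈ w, P x} := by
  let N : DFA α Prop := ⟨fun s x => s ∧ P x, True, {s | s}⟩
  have key : ∀ (w : List α) (s : Prop), N.evalFrom s w ↔ s ∧ ∀ x ∈ w, P x := by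
    intro w
    induction w with
    | nil => intro s; simp
    | cons y w ih => intro s; rw [DFA.evalFrom_cons, ih]; simp [N, and_assoc]
  refine Language.isRegular_iff.2 ⟨Prop, inferInstance, N, ?_⟩
  ext w
  exact (key w True).trans ⟨And.right, And.intro trivial⟩

/-- The words consisting of letters followed by padding symbols form a regular language. -/
theorem isRegular_padded :
    Language.IsRegular {w : List (Option α) |
      ∃ (u : List α) (n : ℕ), w = u.map some ++ List.replicate n none} := by
  let N : DFA (Option α) (Option Bool) :=
    ⟨fun s x => s.bind fun b => if b then some x.isSome else if x.isSome then none else some false,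
      some true, {s | s.isSome}⟩
  have hnone : ∀ w : List (Option α), N.evalFrom none w = none := by
    intro w
    induction w with
    | nil => rfl
    | cons x w ih => rw [DFA.evalFrom_cons]; exact ih
  have hfalse : ∀ w : List (Option α),
      (N.evalFrom (some false) w).isSome ↔ ∃ n, w = List.replicate n none := by
    intro w
    induction w with
    | nil => simp
    | cons x w ih =>
      rw [DFA.evalFrom_cons]
      cases x with
      | none =>
        refine Iff.trans ih ⟨?_, ?_⟩
        · rintro ⟨n, rfl⟩; exact ⟨n + 1, rfl⟩
        · rintro ⟨_ | n, h⟩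
          · simp at h
          · exact ⟨n, by simpa [List.replicate_succ] using h⟩
      | some a =>
        have : N.step (some false) (some a) = none := rfl
        rw [this, hnone]
        simp only [Option.isSome_none, Bool.false_eq_true, false_iff, not_exists]
        rintro (_ | n) h <;> simp [List.replicate_succ] at h
  have htrue : ∀ w : List (Option α), (N.evalFrom (some true) w).isSome ↔
      ∃ (u : List α) (n : ℕ), w = u.map some ++ List.replicate n none := by
    intro w
    induction w with
    | nil => simp
    | cons x w ih =>
      rw [DFA.evalFrom_cons]
      cases x with
      | none =>
        refine Iff.trans (hfalse w) ⟨?_, ?_⟩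
        · rintro ⟨n, rfl⟩; exact ⟨[], n + 1, rfl⟩
        · rintro ⟨_ | ⟨a, u⟩, _ | n, h⟩
          · simp at h
          · exact ⟨n, by simpa [List.replicate_succ] using h⟩
          · simp at h
          · simp at h
      | some a =>
        refine Iff.trans ih ⟨?_, ?_⟩
        · rintro ⟨u, n, rfl⟩; exact ⟨a :: u, n, rfl⟩
        · rintro ⟨_ | ⟨b, u⟩, n, h⟩
          · cases n <;> simp [List.replicate_succ] at h
          · exact ⟨u, n, by simp at h; exact h.2⟩
  refine Language.isRegular_iff.2 ⟨Option Bool, inferInstance, N, ?_⟩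
  ext w
  exact htrue w

end Regular

/-! ### Relations recognized by synchronous automata -/

section Relations

variable {A B C : Type*}

/-- The word `u`, followed by padding symbols up to length `n`. -/
def padTo (u : List A) (n : ℕ) : List (Option A) := (List.range n).map fun k => u[k]?

/-- The pair of words `u`, `v`, both padded up to length `n`. -/
def convolve (u : List A) (v : List B) (n : ℕ) : List (Option A × Option B) :=
  (List.range n).map fun k => (u[k]?, v[k]?)

theorem padTo_eq {u : List A} {n : ℕ} (h : u.length ≤ n) :
    padTo u n = u.map some ++ List.replicate (n - u.length) none := by
  refine List.ext_getElem (by simp [padTo]; omega) fun k h1 h2 => ?_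
  simp only [padTo, List.getElem_map, List.getElem_range, List.getElem_append, List.length_map,
    List.getElem_replicate]
  split_ifs with hk
  · simp [hk]
  · simpa using hk

theorem filterMap_id_padTo {u : List A} {n : ℕ} (h : u.length ≤ n) :
    (padTo u n).filterMap id = u := by
  simp [padTo_eq h, List.filterMap_append, List.filterMap_map]

theorem map_fst_convolve (u : List A) (v : List B) (n : ℕ) :
    (convolve u v n).map Prod.fst = padTo u n := by
  simp [convolve, padTo]

theorem map_snd_convolve (u : List A) (v : List B) (n : ℕ) :
    (convolve u v n).map Prod.snd = padTo v n := by
  simp [convolve, padTo]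

theorem filterMap_fst_convolve {u : List A} (v : List B) {n : ℕ} (h : u.length ≤ n) :
    (convolve u v n).filterMap Prod.fst = u := by
  have := filterMap_id_padTo h
  rwa [← map_fst_convolve u v, List.filterMap_map] at this

theorem filterMap_snd_convolve (u : List A) {v : List B} {n : ℕ} (h : v.length ≤ n) :
    (convolve u v n).filterMap Prod.snd = v := by
  have := filterMap_id_padTo h
  rwa [← map_snd_convolve u v, List.filterMap_map] at this

theorem convolve_eq_of_map_eq {w : List (Option A × Option B)} {u : List A} {v : List B} {n : ℕ}
    (hu : w.map Prod.fst = padTo u n) (hv : w.map Prod.snd = padTo v n) : w = convolve u v n := by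
  rw [← List.zip_unzip w, List.unzip_eq_map, hu, hv]
  simp [padTo, convolve, List.zip_map']

theorem convolve_add (u : List A) (v : List B) {n : ℕ} (hu : u.length ≤ n) (hv : v.length ≤ n)
    (m : ℕ) : convolve u v (n + m) = convolve u v n ++ List.replicate m (none, none) := by
  refine List.ext_getElem (by simp [convolve]) fun k h1 h2 => ?_
  simp only [convolve, List.getElem_map, List.getElem_range, List.getElem_append, List.length_map,
    List.getElem_replicate, List.length_range]
  split_ifs with hk
  · rfl
  · simp; omega

theorem padMap_eq_convolve (u v : List A) :
    padMap u v = convolve u v (max u.length v.length) := by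
  have h1 : v.length - u.length = max u.length v.length - u.length := by omega
  have h2 : u.length - v.length = max u.length v.length - v.length := by omega
  rw [padMap, h1, h2, ← padTo_eq (le_max_left _ _), ← padTo_eq (le_max_right _ _)]
  simp [padTo, convolve]

theorem padMap_inj {u v u' v' : List A} (h : padMap u v = padMap u' v') : u = u' ∧ v = v' := by
  simp only [padMap_eq_convolve] at h
  refine ⟨?_, ?_⟩
  · rw [← filterMap_fst_convolve v (le_max_left u.length v.length), h,
      filterMap_fst_convolve _ (le_max_left _ _)]
  · rw [← filterMap_snd_convolve u (le_max_right u.length v.length), h,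
      filterMap_snd_convolve _ (le_max_right _ _)]

/-- No column of `padMap u v` consists of two padding symbols. -/
theorem ne_none_none_of_mem_padMap {u v : List A} {x : Option A × Option A}
    (hx : x ∈ padMap u v) : x ≠ (none, none) := by
  rw [padMap_eq_convolve] at hx
  simp only [convolve, List.mem_map, List.mem_range] at hx
  obtain ⟨k, hk, rfl⟩ := hx
  simp; omega

open Classical in
theorem filter_convolve {u v : List A} {n : ℕ} (hu : u.length ≤ n) (hv : v.length ≤ n) :
    (convolve u v n).filter (· ≠ (none, none)) = padMap u v := by
  obtain ⟨m, rfl⟩ := Nat.exists_eq_add_of_le (max_le hu hv)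
  rw [convolve_add u v (le_max_left _ _) (le_max_right _ _), ← padMap_eq_convolve,
    List.filter_append, List.filter_eq_self.2, List.filter_eq_nil_iff.2, List.append_nil]
  · intro x hx; simp [List.eq_of_mem_replicate hx]
  · intro x hx; simpa using ne_none_none_of_mem_padMap hx

theorem isRegular_range_padMap :
    Language.IsRegular {p : List (Option A × Option A) | ∃ u v, p = padMap u v} := by
  have h := ((isRegular_map_preimage Prod.fst (isRegular_padded (α := A))).inf
    (isRegular_map_preimage Prod.snd (isRegular_padded (α := A)))).inf
    (isRegular_forall_mem fun x : Option A × Option A => x ≠ (none, none))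
  refine Eq.subst (motive := Language.IsRegular) (Eq.symm ?_) h
  ext p
  constructor
  · rintro ⟨u, v, rfl⟩
    refine ⟨⟨⟨u, max u.length v.length - u.length, ?_⟩, ⟨v, max u.length v.length - v.length, ?_⟩⟩,
      fun x => ne_none_none_of_mem_padMap⟩
    · rw [padMap_eq_convolve, map_fst_convolve, padTo_eq (le_max_left _ _)]
    · rw [padMap_eq_convolve, map_snd_convolve, padTo_eq (le_max_right _ _)]
  · rintro ⟨⟨⟨u, m, hu⟩, ⟨v, n, hv⟩⟩, hp⟩
    have hl : p.length = u.length + m := by simpa using congrArg List.length hu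
    have hl' : p.length = v.length + n := by simpa using congrArg List.length hv
    have hpc : p = convolve u v p.length := by
      refine convolve_eq_of_map_eq ?_ ?_
      · rw [hu, padTo_eq (by omega), hl, Nat.add_sub_cancel_left]
      · rw [hv, padTo_eq (by omega), hl', Nat.add_sub_cancel_left]
    refine ⟨u, v, ?_⟩
    classical
    rw [← filter_convolve (n := p.length) (by omega) (by omega), ← hpc, List.filter_eq_self.2]
    intro x hx
    simpa using hp x hx

/-- A relation between words is recognizable if some regular language contains, among the padded
pairs of words (with arbitrarily long padding), exactly those in the relation. -/
def Recognizable (R : List A → List B → Prop) : Prop :=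
  ∃ K : Language (Option A × Option B), K.IsRegular ∧
    ∀ u v n, u.length ≤ n → v.length ≤ n → (convolve u v n ∈ K ↔ R u v)

theorem Recognizable.and {R Q : List A → List B → Prop} (hR : Recognizable R)
    (hQ : Recognizable Q) : Recognizable fun u v => R u v ∧ Q u v := by
  obtain ⟨K, hK, h⟩ := hR
  obtain ⟨K', hK', h'⟩ := hQ
  exact ⟨K ⊓ K', hK.inf hK', fun u v n hu hv => and_congr (h u v n hu hv) (h' u v n hu hv)⟩

theorem recognizable_mem_left {L : Language A} (hL : L.IsRegular) :
    Recognizable fun (u : List A) (_ : List B) => u ∈ L := by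
  refine ⟨_, isRegular_filterMap_preimage Prod.fst hL, fun u v n hu _ => ?_⟩
  change _ ∈ L ↔ _
  rw [filterMap_fst_convolve v hu]

theorem recognizable_mem_right {L : Language B} (hL : L.IsRegular) :
    Recognizable fun (_ : List A) (v : List B) => v ∈ L := by
  refine ⟨_, isRegular_filterMap_preimage Prod.snd hL, fun u v n _ hv => ?_⟩
  change _ ∈ L ↔ _
  rw [filterMap_snd_convolve u hv]

theorem recognizable_iff_isRegular_padMap (R : List A → List A → Prop) :
    Recognizable R ↔
      Language.IsRegular {p : List (Option A × Option A) | ∃ u v, p = padMap u v ∧ R u v} := by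
  classical
  constructor
  · rintro ⟨K, hK, h⟩
    have hmem : ∀ u v, padMap u v ∈ K ↔ R u v := fun u v => by
      rw [padMap_eq_convolve]; exact h u v _ (le_max_left _ _) (le_max_right _ _)
    refine Eq.subst (motive := Language.IsRegular) (Eq.symm ?_)
      (hK.inf (isRegular_range_padMap (A := A)))
    ext p
    constructor
    · rintro ⟨u, v, rfl, huv⟩
      exact ⟨(hmem u v).2 huv, u, v, rfl⟩
    · rintro ⟨hp, u, v, rfl⟩
      exact ⟨u, v, rfl, (hmem u v).1 hp⟩
  · intro h
    refine ⟨_, isRegular_filterMap_preimage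
      (Option.guard fun x : Option A × Option A => decide (x ≠ (none, none))) h,
      fun u v n hu hv => ?_⟩
    change (∃ u' v', List.filterMap _ (convolve u v n) = padMap u' v' ∧ R u' v') ↔ _
    rw [List.filterMap_eq_filter, filter_convolve hu hv]
    constructor
    · rintro ⟨u', v', he, hR⟩
      obtain ⟨rfl, rfl⟩ := padMap_inj he
      exact hR
    · exact fun hR => ⟨u, v, rfl, hR⟩

theorem recognizable_on_iff_isRegular_padMap (L : Language A) (R : List A → List A → Prop) :
    (Recognizable fun u v => (u ∈ L ∧ v ∈ L) ∧ R u v) ↔ Language.IsRegular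
      {p : List (Option A × Option A) | ∃ u ∈ L, ∃ v ∈ L, p = padMap u v ∧ R u v} := by
  rw [recognizable_iff_isRegular_padMap]
  refine iff_of_eq (congrArg Language.IsRegular (Set.ext fun p => ?_))
  constructor
  · rintro ⟨u, v, rfl, ⟨hu, hv⟩, h⟩
    exact ⟨u, hu, v, hv, rfl, h⟩
  · rintro ⟨u, hu, v, hv, rfl, h⟩
    exact ⟨u, v, rfl, ⟨hu, hv⟩, h⟩

theorem Recognizable.comp {R : List A → List B → Prop} {Q : List B → List C → Prop}
    (hR : Recognizable R) (hQ : Recognizable Q) :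
    Recognizable fun u w => ∃ v, R u v ∧ Q v w := by
  obtain ⟨K, hK, h⟩ := hR
  obtain ⟨K', hK', h'⟩ := hQ
  have hJ := ((isRegular_map_preimage
      (fun x : Option A × Option B × Option C => (x.1, x.2.1)) hK).inf
    (isRegular_map_preimage (fun x : Option A × Option B × Option C => (x.2.1, x.2.2)) hK')).inf
    (isRegular_map_preimage (fun x : Option A × Option B × Option C => x.2.1)
      (isRegular_padded (α := B)))
  refine ⟨_, isRegular_exists_append_replicate (none, none)
    (isRegular_map_image (fun x => (x.1, x.2.2)) hJ), fun u w n hu hw => ?_⟩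
  constructor
  · rintro ⟨m, θ, ⟨⟨h1, h2⟩, v, k, h3⟩, hθ⟩
    rw [← convolve_add u w hu hw] at hθ
    have hlen : θ.length = n + m := by simpa [convolve] using congrArg List.length hθ
    have hlen' : θ.length = v.length + k := by simpa using congrArg List.length h3
    have hfst : θ.map (fun x => x.1) = padTo u (n + m) := by
      rw [← map_fst_convolve u w, ← hθ, List.map_map]; rfl
    have hsnd : θ.map (fun x => x.2.2) = padTo w (n + m) := by
      rw [← map_snd_convolve u w, ← hθ, List.map_map]; rfl
    have hmid : θ.map (fun x => x.2.1) = padTo v (n + m) := by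
      rw [h3, padTo_eq (by omega), ← hlen, hlen', Nat.add_sub_cancel_left]
    have h12 : θ.map (fun x => (x.1, x.2.1)) = convolve u v (n + m) :=
      convolve_eq_of_map_eq (by rw [← hfst, List.map_map]; rfl) (by rw [← hmid, List.map_map]; rfl)
    have h23 : θ.map (fun x => (x.2.1, x.2.2)) = convolve v w (n + m) :=
      convolve_eq_of_map_eq (by rw [← hmid, List.map_map]; rfl) (by rw [← hsnd, List.map_map]; rfl)
    refine ⟨v, (h u v (n + m) (by omega) (by omega)).1 ?_,
      (h' v w (n + m) (by omega) (by omega)).1 ?_⟩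
    · rw [← h12]; exact h1
    · rw [← h23]; exact h2
  · rintro ⟨v, hR, hQ⟩
    refine ⟨v.length, (List.range (n + v.length)).map fun k => (u[k]?, v[k]?, w[k]?),
      ⟨⟨?_, ?_⟩, v, n, ?_⟩, ?_⟩
    · change List.map _ _ ∈ K
      rw [List.map_map]
      exact (h u v (n + v.length) (by omega) (by omega)).2 hR
    · change List.map _ _ ∈ K'
      rw [List.map_map]
      exact (h' v w (n + v.length) (by omega) (by omega)).2 hQ
    · rw [List.map_map]
      refine (padTo_eq (by omega)).trans ?_
      rw [Nat.add_sub_cancel]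
    · rw [List.map_map, ← convolve_add u w hu hw]; rfl

/-- Pulling back a recognizable relation along a partial letter map which, on the words of a
regular language, only erases letters at the end of the word. -/
theorem Recognizable.filterMap {R : List A → List A → Prop} (hR : Recognizable R)
    (f : C → Option A) {G : Language C} (hG : G.IsRegular)
    (hf : ∀ p ∈ G, ∀ k : ℕ, (p.filterMap f)[k]? = p[k]?.bind f) :
    Recognizable fun p q => (p ∈ G ∧ q ∈ G) ∧ R (p.filterMap f) (q.filterMap f) := by
  obtain ⟨K, hK, h⟩ := hR
  obtain ⟨J, hJ, hJ'⟩ := (recognizable_mem_left (B := C) hG).and (recognizable_mem_right hG)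
  refine ⟨J ⊓ {w | w.map (fun x => (x.1.bind f, x.2.bind f)) ∈ K},
    hJ.inf (isRegular_map_preimage _ hK), fun p q n hp hq => ?_⟩
  refine and_congr_right_iff.2 (fun hpq => ?_) |>.trans (and_congr_left' (hJ' p q n hp hq))
  obtain ⟨hpG, hqG⟩ := (hJ' p q n hp hq).1 hpq
  rw [← h _ _ n ((List.length_filterMap_le _ _).trans hp) ((List.length_filterMap_le _ _).trans hq)]
  change List.map _ (convolve p q n) ∈ K ↔ _
  simp only [convolve, List.map_map, hf p hpG, hf q hqG]
  rfl

theorem Recognizable.map {R : List A → List A → Prop} (hR : Recognizable R) (f : C → A) :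
    Recognizable fun p q => R (p.map f) (q.map f) := by
  obtain ⟨K, hK, h⟩ := hR
  refine ⟨{w | w.map (fun x => (x.1.map f, x.2.map f)) ∈ K}, isRegular_map_preimage _ hK,
    fun p q n hp hq => ?_⟩
  refine Iff.trans ?_ (h _ _ n (by simpa using hp) (by simpa using hq))
  change List.map _ (convolve p q n) ∈ K ↔ _
  simp only [convolve, List.map_map, List.getElem?_map]
  rfl

end Relations

/-! ### Evaluation of words in the monoid obtained by adjoining an identity -/

section Evaluation

variable {S : Type*} [Semigroup S] {A : Type*}

/-- The value of a word in `S` with an identity adjoined, the empty word having value `1`. -/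
def evalOne (ψ : A → S) (w : List A) : WithOne S := (w.map fun a => (ψ a : WithOne S)).prod

@[simp]
theorem evalOne_nil (ψ : A → S) : evalOne ψ [] = 1 := rfl

@[simp]
theorem evalOne_cons (ψ : A → S) (a : A) (w : List A) :
    evalOne ψ (a :: w) = ψ a * evalOne ψ w := by simp [evalOne]

@[simp]
theorem evalOne_append (ψ : A → S) (u v : List A) :
    evalOne ψ (u ++ v) = evalOne ψ u * evalOne ψ v := by simp [evalOne]

theorem coe_foldl_mul (ψ : A → S) (s : S) (w : List A) :
    (((w.map ψ).foldl (· * ·) s : S) : WithOne S) = s * evalOne ψ w := by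
  induction w generalizing s with
  | nil => simp
  | cons a w ih => simp [ih, mul_assoc]

theorem evalWord_eq_some_iff (ψ : A → S) (w : List A) (s : S) :
    evalWord ψ w = some s ↔ evalOne ψ w = s := by
  cases w with
  | nil => simp [evalWord]
  | cons a w => rw [evalOne_cons, ← coe_foldl_mul, WithOne.coe_inj]; simp [evalWord]

theorem evalWord_eq_none_iff (ψ : A → S) (w : List A) :
    evalWord ψ w = none ↔ evalOne ψ w = 1 := by
  cases w with
  | nil => simp [evalWord]
  | cons a w => rw [evalOne_cons, ← coe_foldl_mul]; simp [evalWord]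

theorem evalWord_eq_evalWord_iff (ψ : A → S) (u v : List A) :
    evalWord ψ u = evalWord ψ v ↔ evalOne ψ u = evalOne ψ v := by
  cases h : evalWord ψ v with
  | none => rw [evalWord_eq_none_iff, (evalWord_eq_none_iff ψ v).1 h]
  | some s => rw [evalWord_eq_some_iff, (evalWord_eq_some_iff ψ v s).1 h]

theorem exists_coe_eq_evalOne (ψ : A → S) {w : List A} (hw : w ≠ []) :
    ∃ s : S, evalOne ψ w = s := by
  obtain ⟨a, w, rfl⟩ := List.exists_cons_of_ne_nil hw
  exact ⟨_, by rw [evalOne_cons, ← coe_foldl_mul]⟩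

theorem mapMulHom_evalOne {T : Type*} [Semigroup T] (f : S →ₙ* T) (ψ : A → S) (w : List A) :
    WithOne.mapMulHom f (evalOne ψ w) = evalOne (fun a => f (ψ a)) w := by
  induction w with
  | nil => simp
  | cons a w ih => simp [ih]

theorem evalOne_map {B : Type*} (ψ : B → S) (f : A → B) (w : List A) :
    evalOne ψ (w.map f) = evalOne (fun a => ψ (f a)) w := by
  simp [evalOne, Function.comp_def]

theorem withOne_prod_ext {T : Type*} [Semigroup T] {x y : WithOne (S × T)}
    (h₁ : WithOne.mapMulHom (MulHom.fst S T) x = WithOne.mapMulHom (MulHom.fst S T) y)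
    (h₂ : WithOne.mapMulHom (MulHom.snd S T) x = WithOne.mapMulHom (MulHom.snd S T) y) :
    x = y := by
  induction x <;> induction y
  · rfl
  · simp at h₁
  · simp at h₁
  · simp only [WithOne.mapMulHom_coe, WithOne.coe_inj] at h₁ h₂
    exact congrArg _ (Prod.ext h₁ h₂)

end Evaluation

namespace IsAutomaticStructure

variable {S : Type*} [Semigroup S] {A : Type*} [Finite A] {ψ : A → S} {L : Language A}

theorem exists_evalOne_eq (h : IsAutomaticStructure S ψ L) (s : S) : ∃ w ∈ L, evalOne ψ w = s := by
  simpa only [evalWord_eq_some_iff] using h.onto s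

/-- Right multiplication by any element is recognizable. -/
theorem recognizable_mul (h : IsAutomaticStructure S ψ L) (x : WithOne S) :
    Recognizable fun u v => (u ∈ L ∧ v ∈ L) ∧ evalOne ψ u * x = evalOne ψ v := by
  have hword : ∀ w : List A, Recognizable fun u v =>
      (u ∈ L ∧ v ∈ L) ∧ evalOne ψ u * evalOne ψ w = evalOne ψ v := by
    intro w
    induction w using List.reverseRecOn with
    | nil =>
      simpa [recognizable_on_iff_isRegular_padMap, evalWord_eq_evalWord_iff] using h.eq_regular
    | append_singleton w a ih =>
      have ha : Recognizable fun u v =>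
          (u ∈ L ∧ v ∈ L) ∧ evalOne ψ u * evalOne ψ [a] = evalOne ψ v := by
        simpa [recognizable_on_iff_isRegular_padMap, evalWord_eq_evalWord_iff]
          using h.mul_regular a
      convert ih.comp ha using 3 with u v
      constructor
      · rintro ⟨⟨hu, hv⟩, huv⟩
        obtain ⟨s, hs⟩ := exists_coe_eq_evalOne ψ (w := u ++ w) (by simp [h.nonempty_words u hu])
        obtain ⟨z, hz, hzs⟩ := h.exists_evalOne_eq s
        rw [evalOne_append] at hs
        refine ⟨z, ⟨⟨hu, hz⟩, hs.trans hzs.symm⟩, ⟨hz, hv⟩, ?_⟩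
        rw [hzs, ← hs, ← huv, evalOne_append, mul_assoc]
      · rintro ⟨z, ⟨⟨hu, hz⟩, huz⟩, ⟨-, hv⟩, hzv⟩
        exact ⟨⟨hu, hv⟩, by rw [← hzv, ← huz, evalOne_append, mul_assoc]⟩
  induction x with
  | one => exact hword []
  | coe s =>
    obtain ⟨w, -, hw⟩ := h.exists_evalOne_eq s
    rw [← hw]
    exact hword w

/-- In an automatic semigroup `S` with `S² = S`, each generator is a product `z * e` where `e` is
fixed by some left multiplication. -/
theorem exists_eq_mul_fixed (h : IsAutomaticStructure S ψ L)
    (hS : ∀ s : S, ∃ a b : S, s = a * b) (a : A) :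
    ∃ z f e : S, ψ a = z * e ∧ f * e = e := by
  have hfactor : ∀ a : A, ∃ b, ∃ z : S, ψ a = z * ψ b := by
    intro a
    obtain ⟨s, t, hst⟩ := hS (ψ a)
    obtain ⟨w, hw, hwt⟩ := h.exists_evalOne_eq t
    obtain rfl | ⟨w, b, rfl⟩ := w.eq_nil_or_concat'
    · exact absurd rfl (h.nonempty_words _ hw)
    have hval : ((ψ a : S) : WithOne S) = s * evalOne ψ w * ψ b := by
      rw [hst, WithOne.coe_mul, ← hwt, evalOne_append, mul_assoc]; simp
    by_cases hnil : w = []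
    · subst hnil
      exact ⟨b, s, by simpa [← WithOne.coe_mul] using hval⟩
    · obtain ⟨r, hr⟩ := exists_coe_eq_evalOne ψ hnil
      exact ⟨b, s * r, by simpa only [hr, ← WithOne.coe_mul, WithOne.coe_inj] using hval⟩
  choose g hg using hfactor
  have hiter : ∀ (k : ℕ) (a : A), ∃ z : S, ψ a = z * ψ (g^[k + 1] a) := by
    intro k
    induction k with
    | zero => exact hg
    | succ k ih =>
      intro a
      obtain ⟨z, hz⟩ := hg a
      obtain ⟨z', hz'⟩ := ih (g a)
      exact ⟨z * z', by rw [hz, hz', mul_assoc, ← Function.iterate_succ_apply g (k + 1)]⟩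
  obtain ⟨i, j, hij, hgij⟩ :=
    Finite.exists_ne_map_eq_of_infinite fun k : ℕ => g^[k + 1] a
  wlog hlt : i < j generalizing i j
  · exact this j i hij.symm hgij.symm (by omega)
  obtain ⟨d, rfl⟩ := Nat.exists_eq_add_of_lt hlt
  obtain ⟨z, hz⟩ := hiter i a
  obtain ⟨f, hf⟩ := hiter d (g^[i + 1] a)
  refine ⟨z, f, _, hz, ?_⟩
  rw [← Function.iterate_add_apply] at hf
  have he : d + 1 + (i + 1) = i + d + 1 + 1 := by omega
  rw [he] at hf
  exact (hf.trans (congrArg (fun b => f * ψ b) hgij.symm)).symm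

end IsAutomaticStructure

/-! ### Words padded by fixed elements -/

section Padding

/-- The letters of padded words: a generator, or a letter of the block replacing the last letter of
a word. -/
inductive PadLetter (A : Type*)
  | letter (a : A)
  | first (a : A)
  | mid (a : A)
  | last (a : A)

namespace PadLetter

variable {A : Type*}

instance [Finite A] : Finite (PadLetter A) := by
  let g : A ⊕ A ⊕ A ⊕ A → PadLetter A :=
    Sum.elim letter (Sum.elim first (Sum.elim mid last))
  refine Finite.of_surjective g fun x => ?_
  cases x with
  | letter a => exact ⟨.inl a, rfl⟩
  | first a => exact ⟨.inr (.inl a), rfl⟩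
  | mid a => exact ⟨.inr (.inr (.inl a)), rfl⟩
  | last a => exact ⟨.inr (.inr (.inr a)), rfl⟩

/-- The generator recorded by a letter, if any. -/
def strip : PadLetter A → Option A
  | letter a => some a
  | first a => some a
  | mid _ => none
  | last _ => none

/-- The interpretation of the letters, where `a` is to be replaced by `z a * f a ^ n * e a`. -/
def interp {S : Type*} (ψ z f e : A → S) : PadLetter A → S
  | letter a => ψ a
  | first a => z a
  | mid a => f a
  | last a => e a

open Classical in
/-- The automaton recognizing the padded words, that is, words of generators whose last
letter `a` may be replaced by a block `first a, mid a, …, mid a, last a`. -/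
noncomputable def automaton (A : Type*) : DFA (PadLetter A) (Option (A ⊕ Bool)) where
  step
    | some (.inr false), letter _ => some (.inr false)
    | some (.inr false), first a => some (.inl a)
    | some (.inl a), mid b => if a = b then some (.inl a) else none
    | some (.inl a), last b => if a = b then some (.inr true) else none
    | _, _ => none
  start := some (.inr false)
  accept := {s | s = some (.inr false) ∨ s = some (.inr true)}

theorem acceptsFrom_none (w : List (PadLetter A)) : w ∉ (automaton A).acceptsFrom none := by
  induction w with
  | nil => simp [DFA.mem_acceptsFrom, automaton]
  | cons x w ih => exact ih

theorem mem_acceptsFrom_done {w : List (PadLetter A)} :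
    w ∈ (automaton A).acceptsFrom (some (.inr true)) ↔ w = [] := by
  cases w with
  | nil => simp [DFA.mem_acceptsFrom, automaton]
  | cons x w =>
    change w ∈ (automaton A).acceptsFrom none ↔ _
    simpa using acceptsFrom_none w

theorem mem_acceptsFrom_block {a : A} {w : List (PadLetter A)} :
    w ∈ (automaton A).acceptsFrom (some (.inl a)) ↔
      ∃ n, w = List.replicate n (mid a) ++ [last a] := by
  induction w with
  | nil => simp [DFA.mem_acceptsFrom, automaton]
  | cons x w ih =>
    change w ∈ (automaton A).acceptsFrom ((automaton A).step (some (.inl a)) x) ↔ _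
    have hcons : ∀ n, (x :: w = List.replicate n (mid a) ++ [last a]) ↔
        (n = 0 ∧ x = last a ∧ w = []) ∨
          ∃ m, n = m + 1 ∧ x = mid a ∧ w = List.replicate m (mid a) ++ [last a] := by
      rintro (_ | n) <;> simp [List.replicate_succ]
    simp only [hcons]
    cases x with
    | letter b => simpa [automaton] using acceptsFrom_none w
    | first b => simpa [automaton] using acceptsFrom_none w
    | mid b =>
      by_cases hab : a = b
      · subst hab; simpa [automaton] using ih
      · simpa [automaton, hab, Ne.symm hab] using acceptsFrom_none w
    | last b =>
      by_cases hab : a = b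
      · subst hab; simpa [automaton] using mem_acceptsFrom_done
      · simpa [automaton, hab, Ne.symm hab] using acceptsFrom_none w

/-- The words accepted by the automaton, described recursively. -/
theorem cons_mem_accepts {x : PadLetter A} {w : List (PadLetter A)} :
    x :: w ∈ (automaton A).accepts ↔
      (∃ a, x = letter a ∧ w ∈ (automaton A).accepts) ∨
        ∃ a n, x = first a ∧ w = List.replicate n (mid a) ++ [last a] := by
  change w ∈ (automaton A).acceptsFrom ((automaton A).step (some (.inr false)) x) ↔ _
  cases x with
  | letter b => simp [automaton, DFA.accepts]
  | first b => simpa [automaton] using mem_acceptsFrom_block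
  | mid b => simpa [automaton] using acceptsFrom_none w
  | last b => simpa [automaton] using acceptsFrom_none w

theorem isRegular_accepts [Finite A] : (automaton A).accepts.IsRegular := by
  have := Fintype.ofFinite A
  exact Language.isRegular_iff.2 ⟨_, inferInstance, automaton A, rfl⟩

theorem filterMap_strip_block (a : A) (n : ℕ) :
    (List.replicate n (mid a) ++ [last a]).filterMap strip = [] := by
  simp [strip, List.mem_replicate]

theorem getElem?_filterMap_strip {w : List (PadLetter A)} (hw : w ∈ (automaton A).accepts)
    (k : ℕ) : (w.filterMap strip)[k]? = w[k]?.bind strip := by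
  induction w generalizing k with
  | nil => simp
  | cons x w ih =>
    obtain ⟨a, rfl, hw⟩ | ⟨a, n, rfl, rfl⟩ := cons_mem_accepts.1 hw
    · cases k with
      | zero => simp [strip]
      | succ k => simpa [strip] using ih hw k
    · rw [List.filterMap_cons_some (f := strip) (b := a) rfl, filterMap_strip_block]
      cases k with
      | zero => simp [strip]
      | succ k =>
        simp only [List.getElem?_cons_succ, List.getElem?_nil]
        symm
        rw [Option.bind_eq_none_iff]
        intro x hx
        obtain h | h := List.mem_append.1 (List.mem_of_getElem? hx)
        · rw [List.eq_of_mem_replicate h]; rfl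
        · rw [List.mem_singleton.1 h]; rfl

theorem evalOne_interp_block {S : Type*} [Semigroup S] {ψ z f e : A → S}
    (hf : ∀ a, f a * e a = e a) (a : A) (n : ℕ) :
    evalOne (interp ψ z f e) (List.replicate n (mid a) ++ [last a]) = e a := by
  induction n with
  | zero => simp [interp]
  | succ n ih =>
    rw [List.replicate_succ, List.cons_append, evalOne_cons, ih]
    simp [interp, ← WithOne.coe_mul, hf]

theorem evalOne_interp {S : Type*} [Semigroup S] {ψ z f e : A → S}
    (hz : ∀ a, ψ a = z a * e a) (hf : ∀ a, f a * e a = e a) {w : List (PadLetter A)}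
    (hw : w ∈ (automaton A).accepts) :
    evalOne (interp ψ z f e) w = evalOne ψ (w.filterMap strip) := by
  induction w with
  | nil => rfl
  | cons x w ih =>
    obtain ⟨a, rfl, hw⟩ | ⟨a, n, rfl, rfl⟩ := cons_mem_accepts.1 hw
    · simp [strip, interp, ih hw]
    · rw [evalOne_cons, evalOne_interp_block hf, List.filterMap_cons_some (f := strip) (b := a) rfl,
        filterMap_strip_block]
      simp [interp, hz]

/-- A nonempty word can be padded to any greater length. -/
theorem exists_mem_accepts {u : List A} (hu : u ≠ []) {n : ℕ} (hn : u.length ≤ n) :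
    ∃ w ∈ (automaton A).accepts, w.length = n ∧ w.filterMap strip = u := by
  induction u generalizing n with
  | nil => exact absurd rfl hu
  | cons a u ih =>
    have hnil : [] ∈ (automaton A).accepts := .inl rfl
    obtain ⟨m, rfl⟩ := Nat.exists_eq_add_of_le' (le_trans (by simp) hn : 1 ≤ n)
    by_cases hu' : u = []
    · subst hu'
      cases m with
      | zero => exact ⟨[letter a], cons_mem_accepts.2 (.inl ⟨a, rfl, hnil⟩), rfl, rfl⟩
      | succ k =>
        refine ⟨first a :: (List.replicate k (mid a) ++ [last a]),
          cons_mem_accepts.2 (.inr ⟨a, k, rfl, rfl⟩), by simp, ?_⟩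
        rw [List.filterMap_cons_some (f := strip) (b := a) rfl, filterMap_strip_block]
    · obtain ⟨w, hw, hlen, hstrip⟩ := ih hu' (n := m) (by simpa using hn)
      refine ⟨letter a :: w, cons_mem_accepts.2 (.inl ⟨a, rfl, hw⟩), by simp [hlen], ?_⟩
      rw [List.filterMap_cons_some (f := strip) (b := a) rfl, hstrip]

end PadLetter

end Padding

/-! ### The direct product -/

section Product

variable {S T : Type*} [Semigroup S] [Semigroup T]

/-- If `S² = S`, then an automatic semigroup `S` has an automatic structure in which each element
is represented by words of all sufficiently large lengths. -/
theorem IsAutomaticStructure.exists_padded {A : Type} [Finite A] {ψ : A → S} {L : Language A}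
    (h : IsAutomaticStructure S ψ L) (hS : ∀ s : S, ∃ a b : S, s = a * b) :
    ∃ (X : Type) (_ : Finite X) (φ : X → S) (G : Language X), G.IsRegular ∧ [] ∉ G ∧
      (∀ s : S, ∃ m, ∀ n ≥ m, ∃ w ∈ G, w.length = n ∧ evalOne φ w = s) ∧
      ∀ x : WithOne S,
        Recognizable fun p q => (p ∈ G ∧ q ∈ G) ∧ evalOne φ p * x = evalOne φ q := by
  choose z f e hz hf using h.exists_eq_mul_fixed hS
  refine ⟨PadLetter A, inferInstance, PadLetter.interp ψ z f e,
    (PadLetter.automaton A).accepts ⊓ {w | w.filterMap PadLetter.strip ∈ L},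
    PadLetter.isRegular_accepts.inf (isRegular_filterMap_preimage _ h.regular),
    fun hnil => h.nonempty_words [] hnil.2 rfl, fun s => ?_, fun x => ?_⟩
  · obtain ⟨u, hu, hus⟩ := h.exists_evalOne_eq s
    refine ⟨u.length, fun n hn => ?_⟩
    obtain ⟨w, hw, hlen, hstrip⟩ := PadLetter.exists_mem_accepts (h.nonempty_words u hu) hn
    refine ⟨w, ⟨hw, ?_⟩, hlen, ?_⟩
    · change w.filterMap _ ∈ L
      rwa [hstrip]
    · rw [PadLetter.evalOne_interp hz hf hw, hstrip, hus]
  · convert (h.recognizable_mul x).filterMap PadLetter.strip PadLetter.isRegular_accepts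
      (fun p hp => PadLetter.getElem?_filterMap_strip hp) using 3 with p q
    constructor
    · rintro ⟨⟨⟨hp, hp'⟩, ⟨hq, hq'⟩⟩, hpq⟩
      rw [PadLetter.evalOne_interp hz hf hp, PadLetter.evalOne_interp hz hf hq] at hpq
      exact ⟨⟨hp, hq⟩, ⟨hp', hq'⟩, hpq⟩
    · rintro ⟨⟨hp, hq⟩, ⟨hp', hq'⟩, hpq⟩
      rw [← PadLetter.evalOne_interp hz hf hp, ← PadLetter.evalOne_interp hz hf hq] at hpq
      exact ⟨⟨⟨hp, hp'⟩, ⟨hq, hq'⟩⟩, hpq⟩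

theorem evalOne_prod_mul_eq_iff {X Y : Type*} (φ : X → S) (χ : Y → T) (p q : List (X × Y))
    (x : WithOne (S × T)) :
    evalOne (Prod.map φ χ) p * x = evalOne (Prod.map φ χ) q ↔
      evalOne φ (p.map Prod.fst) * WithOne.mapMulHom (MulHom.fst S T) x =
          evalOne φ (q.map Prod.fst) ∧
        evalOne χ (p.map Prod.snd) * WithOne.mapMulHom (MulHom.snd S T) x =
          evalOne χ (q.map Prod.snd) := by
  have h₁ : ∀ w : List (X × Y), evalOne φ (w.map Prod.fst) =
      WithOne.mapMulHom (MulHom.fst S T) (evalOne (Prod.map φ χ) w) := fun w => by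
    rw [mapMulHom_evalOne, evalOne_map]; rfl
  have h₂ : ∀ w : List (X × Y), evalOne χ (w.map Prod.snd) =
      WithOne.mapMulHom (MulHom.snd S T) (evalOne (Prod.map φ χ) w) := fun w => by
    rw [mapMulHom_evalOne, evalOne_map]; rfl
  rw [h₁, h₁, h₂, h₂, ← map_mul, ← map_mul]
  exact ⟨fun h => ⟨congrArg _ h, congrArg _ h⟩, fun h => withOne_prod_ext h.1 h.2⟩

theorem IsAutomaticSemigroup.prod (hS : IsAutomaticSemigroup S) (hT : IsAutomaticSemigroup T)
    (hS' : ∀ s : S, ∃ a b : S, s = a * b) (hT' : ∀ t : T, ∃ a b : T, t = a * b) :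
    IsAutomaticSemigroup (S × T) := by
  obtain ⟨A, _, ψ, L, hA⟩ := hS
  obtain ⟨B, _, ψ', L', hB⟩ := hT
  obtain ⟨X, _, φ, G, hG, hnil, hGonto, hGmul⟩ := hA.exists_padded hS'
  obtain ⟨Y, _, χ, H, hH, -, hHonto, hHmul⟩ := hB.exists_padded hT'
  let M : Language (X × Y) := {w | w.map Prod.fst ∈ G} ⊓ {w | w.map Prod.snd ∈ H}
  have hmul : ∀ x : WithOne (S × T), Recognizable fun p q =>
      (p ∈ M ∧ q ∈ M) ∧ evalOne (Prod.map φ χ) p * x = evalOne (Prod.map φ χ) q := by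
    intro x
    convert ((hGmul (WithOne.mapMulHom (MulHom.fst S T) x)).map (Prod.fst : X × Y → X)).and
      ((hHmul (WithOne.mapMulHom (MulHom.snd S T) x)).map (Prod.snd : X × Y → Y)) using 3 with p q
    rw [evalOne_prod_mul_eq_iff]
    exact ⟨fun ⟨⟨hp, hq⟩, h⟩ => ⟨⟨⟨hp.1, hq.1⟩, h.1⟩, ⟨hp.2, hq.2⟩, h.2⟩,
      fun ⟨⟨h₁, h⟩, h₂, h'⟩ => ⟨⟨⟨h₁.1, h₂.1⟩, h₁.2, h₂.2⟩, h, h'⟩⟩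
  refine ⟨X × Y, inferInstance, Prod.map φ χ, M, ?_, ?_, ?_, ?_, fun c => ?_⟩
  · rintro w hw rfl
    exact hnil hw.1
  · exact (isRegular_map_preimage _ hG).inf (isRegular_map_preimage _ hH)
  · rintro ⟨s, t⟩
    obtain ⟨m, hm⟩ := hGonto s
    obtain ⟨k, hk⟩ := hHonto t
    obtain ⟨u, hu, hulen, hus⟩ := hm (max m k) (le_max_left _ _)
    obtain ⟨v, hv, hvlen, hvt⟩ := hk (max m k) (le_max_right _ _)
    have hfst : (u.zip v).map Prod.fst = u := List.map_fst_zip (by omega)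
    have hsnd : (u.zip v).map Prod.snd = v := List.map_snd_zip (by omega)
    refine ⟨u.zip v, ⟨?_, ?_⟩, ?_⟩
    · change List.map _ _ ∈ G
      rwa [hfst]
    · change List.map _ _ ∈ H
      rwa [hsnd]
    · rw [evalWord_eq_some_iff]
      refine withOne_prod_ext ?_ ?_
      · rw [mapMulHom_evalOne, WithOne.mapMulHom_coe]
        refine Eq.trans ?_ hus
        conv_rhs => rw [← hfst, evalOne_map]
        rfl
      · rw [mapMulHom_evalOne, WithOne.mapMulHom_coe]
        refine Eq.trans ?_ hvt
        conv_rhs => rw [← hsnd, evalOne_map]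
        rfl
  · have := hmul 1
    rw [recognizable_on_iff_isRegular_padMap] at this
    simpa [evalWord_eq_evalWord_iff] using this
  · have := hmul (Prod.map φ χ c : S × T)
    rw [recognizable_on_iff_isRegular_padMap] at this
    simpa [evalWord_eq_evalWord_iff] using this

/-- In a finitely generated semigroup, all but finitely many elements are products. -/
theorem IsAutomaticSemigroup.finite_setOf_not_mul (h : IsAutomaticSemigroup S) :
    {s : S | ¬ ∃ a b, s = a * b}.Finite := by
  obtain ⟨A, _, ψ, L, hA⟩ := h
  refine (Set.finite_range ψ).subset fun s hs => ?_
  obtain ⟨w, hw, hws⟩ := hA.exists_evalOne_eq s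
  obtain ⟨a, w, rfl⟩ := List.exists_cons_of_ne_nil (hA.nonempty_words w hw)
  by_cases hnil : w = []
  · subst hnil
    exact ⟨a, by simpa using hws⟩
  · obtain ⟨r, hr⟩ := exists_coe_eq_evalOne ψ hnil
    rw [evalOne_cons, hr, ← WithOne.coe_mul, WithOne.coe_inj] at hws
    exact absurd ⟨_, _, hws.symm⟩ hs

end Product

end AutoSg

open AutoSg in
/-- For infinite automatic semigroups `S`, `T`, the direct product `S × T` is
automatic iff `S² = S` and `T² = T`. -/
theorem prod_automatic_iff_of_infinite (S T : Type*) [Semigroup S] [Semigroup T]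
    [Infinite S] [Infinite T]
    (hS : IsAutomaticSemigroup S) (hT : IsAutomaticSemigroup T) :
    IsAutomaticSemigroup (S × T) ↔
      ((∀ s : S, ∃ a b : S, s = a * b) ∧ (∀ t : T, ∃ a b : T, t = a * b)) := by
  refine ⟨fun h => ⟨fun s => ?_, fun t => ?_⟩, fun h => hS.prod hT h.1 h.2⟩
  · by_contra hs
    refine Set.infinite_range_of_injective (Prod.mk_right_injective (β := T) s)
      (h.finite_setOf_not_mul.subset ?_)
    rintro _ ⟨t, rfl⟩ ⟨a, b, hab⟩
    exact hs ⟨a.1, b.1, congrArg Prod.fst hab⟩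
  · by_contra ht
    refine Set.infinite_range_of_injective (Prod.mk_left_injective (α := S) t)
      (h.finite_setOf_not_mul.subset ?_)
    rintro _ ⟨s, rfl⟩ ⟨a, b, hab⟩
    exact ht ⟨a.2, b.2, congrArg Prod.snd hab⟩
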